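/- Let (V, ⟨,⟩) be a 2n-dimensional complex symplectic vector space. The variety M_lag of all linear maps M : Cⁿ → V whose image is isotropic is an irreducible local complete intersection of codimension n(n-1)/2 in Hom(Cⁿ, V), hence of dimension 2n² - n(n-1)/2. -/

import Mathlib

/-!
STATEMENT 2: For a `2n`-dimensional complex symplectic vector space `(V, B)`
(here `V = ℂ²ⁿ`), the variety `M_lag` of all linear maps `M : ℂⁿ → V` with isotropic
image is an irreducible local complete intersection of codimension `n(n-1)/2` in
`Hom(ℂⁿ, V) ≅ ℂ^{2n²}`: it is cut out by `n(n-1)/2` polynomial equations and has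
dimension `2n² - n(n-1)/2`.
-/

/-- A subset of affine space `ι → ℂ` is an (affine) algebraic set if it is the common
zero locus of a set of polynomials. -/
def IsAlgSet {ι : Type} [Fintype ι] (S : Set (ι → ℂ)) : Prop :=
  ∃ P : Set (MvPolynomial ι ℂ), S = {x | ∀ p ∈ P, MvPolynomial.eval x p = 0}

/-- The Zariski closure of a subset of affine space. -/
def zarClosure {ι : Type} [Fintype ι] (S : Set (ι → ℂ)) : Set (ι → ℂ) :=
  ⋂₀ {T | IsAlgSet T ∧ S ⊆ T}

/-- An algebraic set is irreducible if it is nonempty and is not contained in the union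
of two algebraic sets without being contained in one of them. -/
def IsIrrAlg {ι : Type} [Fintype ι] (S : Set (ι → ℂ)) : Prop :=
  IsAlgSet S ∧ S.Nonempty ∧
    ∀ T₁ T₂ : Set (ι → ℂ), IsAlgSet T₁ → IsAlgSet T₂ → S ⊆ T₁ ∪ T₂ → S ⊆ T₁ ∨ S ⊆ T₂

/-- The dimension of a subset of affine space: the Krull dimension of the poset of
irreducible algebraic subsets of its Zariski closure. -/
noncomputable def algDim {ι : Type} [Fintype ι] (S : Set (ι → ℂ)) : WithBot ℕ∞ :=
  Order.krullDim {T : Set (ι → ℂ) // IsIrrAlg T ∧ T ⊆ zarClosure S}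

/-- The linear map `ℂⁿ → ℂ²ⁿ` associated to a point of the affine space of
`2n × n` matrices. -/
noncomputable def matToLin (n : ℕ) (m : Fin (2 * n) × Fin n → ℂ) :
    (Fin n → ℂ) →ₗ[ℂ] (Fin (2 * n) → ℂ) :=
  Matrix.mulVecLin (Matrix.of fun r c => m (r, c))



namespace Lag
open MvPolynomial

theorem zarClosure_eq {ι : Type} [Fintype ι] {S : Set (ι → ℂ)} (h : IsAlgSet S) :
    zarClosure S = S := by
  apply Set.Subset.antisymm
  · exact Set.sInter_subset_of_mem ⟨h, Set.Subset.rfl⟩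
  · exact Set.subset_sInter fun T hT => hT.2

theorem isAlgSet_iff {ι : Type} [Fintype ι] {S : Set (ι → ℂ)} :
    IsAlgSet S ↔ zeroLocus ℂ (vanishingIdeal ℂ S) = S := by
  constructor
  · rintro ⟨P, hP⟩
    apply Set.Subset.antisymm
    · intro x hx
      rw [hP]
      intro p hp
      rw [← aeval_eq_eval]
      refine hx p ?_
      rw [mem_vanishingIdeal_iff]
      intro y hy
      rw [hP] at hy
      rw [aeval_eq_eval]
      exact hy p hp
    · exact zeroLocus_vanishingIdeal_le S
  · intro h
    refine ⟨(vanishingIdeal ℂ S : Ideal (MvPolynomial ι ℂ)), ?_⟩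
    conv_lhs => rw [← h]
    ext x
    simp only [mem_zeroLocus_iff, aeval_eq_eval]
    rfl

theorem isAlgSet_zeroLocus {ι : Type} [Fintype ι] (I : Ideal (MvPolynomial ι ℂ)) :
    IsAlgSet (zeroLocus ℂ I) :=
  ⟨I, by ext x; simp only [mem_zeroLocus_iff, aeval_eq_eval]; rfl⟩

theorem isIrr_iff {ι : Type} [Fintype ι] {S : Set (ι → ℂ)} (h : IsAlgSet S) :
    IsIrrAlg S ↔ (vanishingIdeal ℂ S : Ideal (MvPolynomial ι ℂ)).IsPrime := by
  constructor
  · rintro ⟨_, ⟨x, hx⟩, hirr⟩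
    refine ⟨?_, ?_⟩
    · rw [Ideal.ne_top_iff_one]
      intro h1
      have := h1 x hx
      simp at this
    · intro p q hpq
      have := hirr (zeroLocus ℂ (Ideal.span {p})) (zeroLocus ℂ (Ideal.span {q}))
        (isAlgSet_zeroLocus _) (isAlgSet_zeroLocus _) ?_
      · rw [zeroLocus_span, zeroLocus_span] at this
        rcases this with h1 | h1
        · left; intro y hy; exact h1 hy p rfl
        · right; intro y hy; exact h1 hy q rfl
      · intro y hy
        have := hpq y hy
        rw [map_mul, mul_eq_zero] at this
        rw [zeroLocus_span, zeroLocus_span]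
        rcases this with h1 | h1
        · left; rintro _ rfl; exact h1
        · right; rintro _ rfl; exact h1
  · intro hp
    refine ⟨h, ?_, ?_⟩
    · rw [Set.nonempty_iff_ne_empty]
      rintro rfl
      exact hp.ne_top vanishingIdeal_empty
    · rintro T₁ T₂ ⟨P, rfl⟩ ⟨Q, rfl⟩ hS
      by_contra! hcon
      obtain ⟨h1, h2⟩ := hcon
      rw [Set.not_subset] at h1 h2
      obtain ⟨x, hx, h1⟩ := h1
      obtain ⟨y, hy, h2⟩ := h2
      simp only [Set.mem_ofPred_eq, not_forall] at h1 h2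
      obtain ⟨p, hpP, h1⟩ := h1
      obtain ⟨q, hqQ, h2⟩ := h2
      have : p * q ∈ (vanishingIdeal ℂ S : Ideal (MvPolynomial ι ℂ)) := by
        intro z hz
        rw [map_mul, aeval_eq_eval]
        rcases hS hz with h3 | h3
        · exact mul_eq_zero_of_left (h3 p hpP) _
        · exact mul_eq_zero_of_right _ (h3 q hqQ)
      rcases hp.mem_or_mem this with h3 | h3
      · exact h1 (by simpa [aeval_eq_eval] using h3 x hx)
      · exact h2 (by simpa [aeval_eq_eval] using h3 y hy)

noncomputable def irrIso {ι : Type} [Fintype ι] {S : Set (ι → ℂ)} (h : IsAlgSet S) :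
    {T : Set (ι → ℂ) // IsIrrAlg T ∧ T ⊆ zarClosure S} ≃o
      (PrimeSpectrum.zeroLocus
        ((vanishingIdeal ℂ S : Ideal (MvPolynomial ι ℂ)) : Set (MvPolynomial ι ℂ)))ᵒᵈ where
  toFun T := OrderDual.toDual ⟨⟨vanishingIdeal ℂ T.1, (isIrr_iff T.2.1.1).1 T.2.1⟩,
    vanishingIdeal_anti_mono (T.2.2.trans (zarClosure_eq h).subset)⟩
  invFun J := ⟨zeroLocus ℂ (OrderDual.ofDual J).1.asIdeal, by
    obtain ⟨⟨J, hJ⟩, hJS⟩ := J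
    have hJS : vanishingIdeal ℂ S ≤ J := hJS
    refine ⟨(isIrr_iff (isAlgSet_zeroLocus _)).2 ?_, ?_⟩
    · change (vanishingIdeal ℂ (zeroLocus ℂ J)).IsPrime
      rw [IsPrime.vanishingIdeal_zeroLocus]; exact hJ
    · exact (zeroLocus_anti_mono hJS).trans
        ((isAlgSet_iff.1 h).subset.trans (zarClosure_eq h).superset)⟩
  left_inv T := Subtype.ext (isAlgSet_iff.1 T.2.1.1)
  right_inv J := by
    obtain ⟨⟨J, hJ⟩, hJS⟩ := J
    apply Subtype.ext
    apply PrimeSpectrum.ext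
    exact IsPrime.vanishingIdeal_zeroLocus J
  map_rel_iff' {T U} := by
    change (vanishingIdeal ℂ U.1 : Ideal (MvPolynomial ι ℂ)) ≤ vanishingIdeal ℂ T.1 ↔ T.1 ⊆ U.1
    constructor
    · intro h1
      rw [← isAlgSet_iff.1 T.2.1.1, ← isAlgSet_iff.1 U.2.1.1]
      exact zeroLocus_anti_mono h1
    · intro h1; exact vanishingIdeal_anti_mono h1

theorem algDim_eq {ι : Type} [Fintype ι] {S : Set (ι → ℂ)} (h : IsAlgSet S) :
    algDim S = ringKrullDim (MvPolynomial ι ℂ ⧸ (vanishingIdeal ℂ S : Ideal (MvPolynomial ι ℂ))) := by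
  rw [ringKrullDim_quotient, algDim, Order.krullDim_eq_of_orderIso (irrIso h),
    Order.krullDim_orderDual]

theorem dim_of_trdeg (R : Type) [CommRing R] [IsDomain R] [Algebra ℂ R] [Algebra.FiniteType ℂ R]
    (d : ℕ) (hd : Algebra.trdeg ℂ R = d) : ringKrullDim R = d := by
  obtain ⟨s, g, hg, hgi⟩ := exists_integral_inj_algHom_of_fg ℂ R
  let := g.toRingHom.toAlgebra
  have : IsScalarTower ℂ (MvPolynomial (Fin s) ℂ) R :=
    IsScalarTower.of_algebraMap_eq fun x => (g.commutes x).symm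
  have : Algebra.IsIntegral (MvPolynomial (Fin s) ℂ) R := ⟨hgi⟩
  have : FaithfulSMul (MvPolynomial (Fin s) ℂ) R :=
    (faithfulSMul_iff_algebraMap_injective _ _).2 hg
  have h1 := _root_.trdeg_add_eq ℂ (MvPolynomial (Fin s) ℂ) (A := R)
  rw [trdeg_eq_zero (R := MvPolynomial (Fin s) ℂ) (A := R), MvPolynomial.trdeg_of_isDomain, hd] at h1
  have hs : s = d := by simpa using h1
  have h2 : ringKrullDim (MvPolynomial (Fin s) ℂ) = s := by
    rw [MvPolynomial.ringKrullDim_of_isNoetherianRing]; simp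
  rw [← hs, ← h2]
  apply le_antisymm
  · apply Order.krullDim_le_of_strictMono
      (fun p : PrimeSpectrum R => PrimeSpectrum.comap (algebraMap (MvPolynomial (Fin s) ℂ) R) p)
    intro p q hpq
    exact Ideal.IsIntegral.comap_lt_comap (R := MvPolynomial (Fin s) ℂ) hpq
  · apply iSup_le
    intro l
    obtain ⟨P, hP, hPl⟩ := Ideal.exists_ideal_over_prime_of_isIntegral_of_isDomain (S := R)
      l.head.asIdeal (by
        rw [(RingHom.injective_iff_ker_eq_bot (algebraMap (MvPolynomial (Fin s) ℂ) R)).1 hg]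
        exact bot_le)
    have : P.LiesOver (RelSeries.head l).asIdeal := ⟨hPl.symm⟩
    obtain ⟨L, hL, -⟩ := Ideal.exists_ltSeries_of_hasGoingUp l P
    rw [← hL]
    exact le_iSup (fun q : LTSeries (PrimeSpectrum R) => (q.length : WithBot ℕ∞)) L
end Lag

namespace Lag

theorem symp_step {V : Type} [AddCommGroup V] [Module ℂ V] [FiniteDimensional ℂ V]
    (B : LinearMap.BilinForm ℂ V) (halt : ∀ v, B v v = 0)
    (hnondeg : ∀ v, (∀ w, B v w = 0) → v = 0) (n : ℕ) (hV : Module.finrank ℂ V = 2 * n) (k : ℕ)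
    (hk : k ≤ n) :
    ∃ e f : Fin k → V, (∀ i j, B (e i) (e j) = 0) ∧ (∀ i j, B (f i) (f j) = 0) ∧
      ∀ i j, B (e i) (f j) = if i = j then 1 else 0 := by
  have hneg : ∀ v w, B v w = - B w v := by
    intro v w
    have := halt (v + w)
    simp only [map_add, LinearMap.add_apply, halt] at this
    linear_combination this
  induction k with
  | zero => exact ⟨Fin.elim0, Fin.elim0, fun i => i.elim0, fun i => i.elim0, fun i => i.elim0⟩
  | succ k ih =>
    obtain ⟨e, f, hee, hff, hef⟩ := ih (by omega)
    have hfe : ∀ i j, B (f i) (e j) = if i = j then -1 else 0 := by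
      intro i j
      rw [hneg, hef]
      by_cases h : i = j
      · simp [h]
      · simp [h, Ne.symm h]
    let g : V →ₗ[ℂ] (Fin k → ℂ) × (Fin k → ℂ) :=
      LinearMap.prod (LinearMap.pi fun i => B (e i)) (LinearMap.pi fun i => B (f i))
    have hker : LinearMap.ker g ≠ ⊥ := by
      apply LinearMap.ker_ne_bot_of_finrank_lt
      simp [hV]
      omega
    obtain ⟨u, hu, hu0⟩ := Submodule.exists_mem_ne_zero_of_ne_bot hker
    have hu' : g u = 0 := hu
    have hue : ∀ i, B (e i) u = 0 := fun i => congrFun (congrArg Prod.fst hu') i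
    have huf : ∀ i, B (f i) u = 0 := fun i => congrFun (congrArg Prod.snd hu') i
    have hw : ∃ w, B u w ≠ 0 := by
      by_contra! h
      exact hu0 (hnondeg u h)
    obtain ⟨w, hw⟩ := hw
    let w₁ := (B u w)⁻¹ • w
    have hw₁ : B u w₁ = 1 := by simp [w₁, hw]
    let w₂ := w₁ - ∑ i, B w₁ (f i) • e i + ∑ i, B w₁ (e i) • f i
    have hw₂e : ∀ j, B (e j) w₂ = 0 := by
      intro j
      simp only [w₂, map_add, map_sub, map_sum, map_smul, hee, hef]
      simp [hneg (e j) w₁]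
    have hw₂f : ∀ j, B (f j) w₂ = 0 := by
      intro j
      simp only [w₂, map_add, map_sub, map_sum, map_smul, hfe, hff]
      simp [hneg (f j) w₁]
    have huw : B u w₂ = 1 := by
      simp only [w₂, map_add, map_sub, map_sum, map_smul, hneg u (e _), hneg u (f _), hue, huf, hw₁]
      simp
    refine ⟨Fin.cons u e, Fin.cons w₂ f, ?_, ?_, ?_⟩
    · intro i j
      refine Fin.cases ?_ (fun i => ?_) i <;> refine Fin.cases ?_ (fun j => ?_) j <;>
        simp [halt, hee, hue, hneg u (e _)]
    · intro i j
      refine Fin.cases ?_ (fun i => ?_) i <;> refine Fin.cases ?_ (fun j => ?_) j <;>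
        simp [halt, hff, hw₂f, hneg w₂ (f _)]
    · intro i j
      refine Fin.cases ?_ (fun i => ?_) i <;> refine Fin.cases ?_ (fun j => ?_) j
      · simp [huw]
      · simp [hneg u (f _), huf, (Fin.succ_ne_zero _).symm]
      · simp [hw₂e]
      · simp [hef]

open Matrix Topology Filter

theorem eventually_det {m : Type} [Fintype m] [DecidableEq m] (G : Matrix m m ℂ) :
    ∀ᶠ s in 𝓝[≠] (0 : ℂ), (G + s • (1 : Matrix m m ℂ)).det ≠ 0 := by
  have hfin : ((-G).charpoly.rootSet ℂ \ {0}).Finite := (Polynomial.rootSet_finite _ ℂ).sdiff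
  have h1 : ((-G).charpoly.rootSet ℂ \ {0})ᶜ ∈ 𝓝 (0 : ℂ) :=
    hfin.isClosed.isOpen_compl.mem_nhds (by simp)
  filter_upwards [self_mem_nhdsWithin, mem_nhdsWithin_of_mem_nhds h1] with s hs0 hs hdet
  apply hs
  refine ⟨?_, hs0⟩
  rw [Polynomial.mem_rootSet_of_ne (Matrix.charpoly_monic _).ne_zero]
  rw [Polynomial.coe_aeval_eq_eval, Matrix.eval_charpoly, ← hdet]
  congr 1
  rw [sub_neg_eq_add, add_comm, Matrix.smul_one_eq_diagonal, Matrix.scalar_apply]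

theorem density_diag {n : ℕ} (d : Fin n → ℂ) (C : Matrix (Fin n) (Fin n) ℂ)
    (h : (diagonal d * C)ᵀ = diagonal d * C) :
    ∃ A' C' : ℂ → Matrix (Fin n) (Fin n) ℂ, Continuous A' ∧ Continuous C' ∧
      A' 0 = diagonal d ∧ C' 0 = C ∧ (∀ s, ((A' s)ᵀ * C' s)ᵀ = (A' s)ᵀ * C' s) ∧
      ∀ᶠ s in 𝓝[≠] (0 : ℂ), (A' s).det ≠ 0 := by
  let E : Matrix (Fin n) (Fin n) ℂ := diagonal fun i => if d i = 0 then 1 else 0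
  have hc : Continuous fun s : ℂ => diagonal d + s • (C + s • E) := by fun_prop
  refine ⟨fun s => diagonal d + s • (C + s • E), fun s => C + s • E, hc,
    by fun_prop, by simp, by simp, ?_, ?_⟩
  · intro s
    have hE : diagonal d * E = 0 := by
      ext i j
      simp only [E, Matrix.diagonal_mul_diagonal, Matrix.diagonal_apply, Matrix.zero_apply]
      split_ifs <;> simp_all
    have h2 : diagonal d * (C + s • E) = diagonal d * C := by
      rw [mul_add, Matrix.mul_smul, hE]; simp
    have : (diagonal d + s • (C + s • E))ᵀ * (C + s • E) =
        diagonal d * C + s • ((C + s • E)ᵀ * (C + s • E)) := by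
      rw [transpose_add, diagonal_transpose, add_mul, h2, transpose_smul, Matrix.smul_mul]
    change ((diagonal d + s • (C + s • E))ᵀ * (C + s • E))ᵀ =
      (diagonal d + s • (C + s • E))ᵀ * (C + s • E)
    rw [this, transpose_add, h, transpose_smul, transpose_mul, transpose_transpose]
  · have hC : ∀ i j, d i ≠ 0 → d j = 0 → C i j = 0 := by
      intro i j hi hj
      have := congrFun (congrFun h i) j
      simp only [transpose_apply, diagonal_mul, hj, zero_mul] at this
      simpa [hi] using this.symm
    have h1 : ∀ᶠ s in 𝓝[≠] (0 : ℂ),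
        (toSquareBlockProp (diagonal d + s • (C + s • E)) fun i => d i ≠ 0).det ≠ 0 := by
      apply Filter.Eventually.filter_mono nhdsWithin_le_nhds
      have hc2 : Continuous fun s : ℂ =>
          (toSquareBlockProp (diagonal d + s • (C + s • E)) fun i => d i ≠ 0).det := by
        apply Continuous.matrix_det
        exact hc.matrix_submatrix _ _
      apply hc2.continuousAt.eventually_ne
      have : toSquareBlockProp (diagonal d + (0 : ℂ) • (C + (0 : ℂ) • E)) (fun i => d i ≠ 0) =
          diagonal fun i : {i // d i ≠ 0} => d i := by
        ext i j
        simp [toSquareBlockProp, Matrix.diagonal_apply, Subtype.ext_iff]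
      rw [this, det_diagonal]
      exact Finset.prod_ne_zero_iff.2 fun i _ => i.2
    have h2 := eventually_det (toSquareBlockProp C fun i => ¬ d i ≠ 0)
    filter_upwards [h1, h2, self_mem_nhdsWithin] with s hs1 hs2 hs0
    rw [twoBlockTriangular_det' _ (fun i => d i ≠ 0)]
    · apply mul_ne_zero hs1
      have : toSquareBlockProp (diagonal d + s • (C + s • E)) (fun i => ¬ d i ≠ 0) =
          s • (toSquareBlockProp C (fun i => ¬ d i ≠ 0) + s • 1) := by
        ext i j
        have hi := not_not.1 i.2
        simp [toSquareBlockProp, Matrix.diagonal_apply, E, hi, Matrix.one_apply, Subtype.ext_iff]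
        split_ifs <;> ring
      rw [this, det_smul]
      exact mul_ne_zero (pow_ne_zero _ hs0) hs2
    · intro i hi j hj
      have hij : i ≠ j := by rintro rfl; exact hj hi
      simp [E, hij, hC i j hi (not_not.1 hj)]

theorem density {n : ℕ} (A C : Matrix (Fin n) (Fin n) ℂ) (h : (Aᵀ * C)ᵀ = Aᵀ * C) :
    ∃ A' C' : ℂ → Matrix (Fin n) (Fin n) ℂ, Continuous A' ∧ Continuous C' ∧
      A' 0 = A ∧ C' 0 = C ∧ (∀ s, ((A' s)ᵀ * C' s)ᵀ = (A' s)ᵀ * C' s) ∧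
      ∀ᶠ s in 𝓝[≠] (0 : ℂ), (A' s).det ≠ 0 := by
  obtain ⟨L, L', d, hA⟩ := Pivot.exists_list_transvec_mul_diagonal_mul_list_transvec A
  have hP : (L.map TransvectionStruct.toMatrix).prod.det = 1 := by simp
  have hQ : (L'.map TransvectionStruct.toMatrix).prod.det = 1 := by simp
  generalize (L.map TransvectionStruct.toMatrix).prod = P at *
  generalize (L'.map TransvectionStruct.toMatrix).prod = Q at *
  have hPu : IsUnit P.det := by simp [hP]
  have hQu : IsUnit Q.det := by simp [hQ]
  have hPP := nonsing_inv_mul P hPu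
  have hPP' := mul_nonsing_inv P hPu
  have hQQ := nonsing_inv_mul Q hQu
  have hQQ' := mul_nonsing_inv Q hQu
  have hPT : P⁻¹ᵀ * Pᵀ = 1 := by rw [← transpose_mul, hPP', transpose_one]
  have hPT' : Pᵀ * P⁻¹ᵀ = 1 := by rw [← transpose_mul, hPP, transpose_one]
  have hQT : Q⁻¹ᵀ * Qᵀ = 1 := by rw [← transpose_mul, hQQ', transpose_one]
  have e1 : diagonal d * (Pᵀ * C * Q⁻¹) = Q⁻¹ᵀ * (Aᵀ * C) * Q⁻¹ := by
    rw [hA]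
    simp only [transpose_mul, diagonal_transpose, ← mul_assoc, hQT, one_mul]
  obtain ⟨A', C', hA', hC', hA0, hC0, hs, hd⟩ := density_diag d (Pᵀ * C * Q⁻¹) (by
    rw [e1]
    rw [transpose_mul _ Q⁻¹, transpose_mul Q⁻¹ᵀ, transpose_transpose, h, ← mul_assoc])
  refine ⟨fun s => P * A' s * Q, fun s => P⁻¹ᵀ * C' s * Q, by fun_prop, by fun_prop, ?_, ?_, ?_, ?_⟩
  · simp only [hA0, hA]
  · simp only [hC0, ← mul_assoc, hPT, one_mul]
    rw [mul_assoc, hQQ, mul_one]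
  · intro s
    have : (P * A' s * Q)ᵀ * (P⁻¹ᵀ * C' s * Q) = Qᵀ * ((A' s)ᵀ * C' s) * Q := by
      calc _ = Qᵀ * ((A' s)ᵀ * (Pᵀ * P⁻¹ᵀ) * C' s) * Q := by
            simp only [transpose_mul, mul_assoc]
        _ = _ := by rw [hPT', mul_one]
    rw [this, transpose_mul, transpose_mul, hs, transpose_transpose, ← mul_assoc]
  · filter_upwards [hd] with s hs
    simp [det_mul, hP, hQ, hs]

end Lag

namespace Lag
open Matrix Topology Filter MvPolynomial

abbrev EV (n : ℕ) : Type := (Fin n × Fin n) ⊕ Sym2 (Fin n)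

noncomputable def XA (n : ℕ) : Matrix (Fin n) (Fin n) (MvPolynomial (EV n) ℂ) :=
  Matrix.of fun i k => X (Sum.inl (i, k))

noncomputable def XS (n : ℕ) : Matrix (Fin n) (Fin n) (MvPolynomial (EV n) ℂ) :=
  Matrix.of fun i k => X (Sum.inr s(i, k))

noncomputable def XC (n : ℕ) : Matrix (Fin n) (Fin n) (MvPolynomial (EV n) ℂ) :=
  (XA n).adjugateᵀ * XS n

def vA {n : ℕ} (x : EV n → ℂ) : Matrix (Fin n) (Fin n) ℂ := Matrix.of fun i k => x (Sum.inl (i, k))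

def vS {n : ℕ} (x : EV n → ℂ) : Matrix (Fin n) (Fin n) ℂ := Matrix.of fun i k => x (Sum.inr s(i, k))

noncomputable def vC {n : ℕ} (x : EV n → ℂ) : Matrix (Fin n) (Fin n) ℂ :=
  (vA x).adjugateᵀ * vS x

noncomputable def FF {n : ℕ} (e f : Fin n → Fin (2 * n) → ℂ) (rk : Fin (2 * n) × Fin n) :
    MvPolynomial (EV n) ℂ :=
  ∑ i, (C (e i rk.1) * XA n i rk.2 + C (f i rk.1) * XC n i rk.2)

def pt {n : ℕ} (e f : Fin n → Fin (2 * n) → ℂ) (P Q : Matrix (Fin n) (Fin n) ℂ)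
    (rk : Fin (2 * n) × Fin n) : ℂ :=
  ∑ i, (e i rk.1 * P i rk.2 + f i rk.1 * Q i rk.2)

theorem map_XA {n : ℕ} (x : EV n → ℂ) : (XA n).map (eval x) = vA x := by
  ext i j; simp [XA, vA]

theorem map_XC {n : ℕ} (x : EV n → ℂ) : (XC n).map (eval x) = vC x := by
  have h1 : (XA n).adjugate.map (eval x) = (vA x).adjugate := by
    have := RingHom.map_adjugate (eval x) (XA n)
    rw [RingHom.mapMatrix_apply, RingHom.mapMatrix_apply, map_XA] at this
    exact this
  have h2 : (XS n).map (eval x) = vS x := by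
    ext i j; simp [XS, vS]
  rw [XC, Matrix.map_mul, vC, ← h1, ← h2, transpose_map]

theorem eval_FF {n : ℕ} (e f : Fin n → Fin (2 * n) → ℂ) (x : EV n → ℂ) :
    (fun rk => eval x (FF e f rk)) = pt e f (vA x) (vC x) := by
  funext rk
  simp only [FF, pt, map_sum, map_add, map_mul, eval_C, ← map_XA, ← map_XC, Matrix.map_apply]

def col {n : ℕ} (m : Fin (2 * n) × Fin n → ℂ) (k : Fin n) : Fin (2 * n) → ℂ := fun r => m (r, k)

theorem matToLin_eq {n : ℕ} (m : Fin (2 * n) × Fin n → ℂ) (x : Fin n → ℂ) :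
    matToLin n m x = ∑ k, x k • col m k := by
  funext r
  simp [matToLin, Matrix.mulVec, dotProduct, col, mul_comm]

theorem lag_iff {n : ℕ} (B : LinearMap.BilinForm ℂ (Fin (2 * n) → ℂ))
    (m : Fin (2 * n) × Fin n → ℂ) :
    (∀ x y : Fin n → ℂ, B (matToLin n m x) (matToLin n m y) = 0) ↔
      ∀ k l, B (col m k) (col m l) = 0 := by
  constructor
  · intro h k l
    have := h (Pi.single k 1) (Pi.single l 1)
    simpa [matToLin_eq, Pi.single_apply] using this
  · intro h x y
    simp [matToLin_eq, h]

theorem bilin_expand {n : ℕ} (B : LinearMap.BilinForm ℂ (Fin (2 * n) → ℂ))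
    (v w : Fin (2 * n) → ℂ) :
    B v w = ∑ r, ∑ s, B (Pi.single r 1) (Pi.single s 1) * v r * w s := by
  conv_lhs => rw [pi_eq_sum_univ' v, pi_eq_sum_univ' w]
  simp only [map_sum, LinearMap.sum_apply, map_smul, LinearMap.smul_apply, smul_eq_mul]
  simp only [Finset.mul_sum]
  rw [Finset.sum_comm]
  refine Finset.sum_congr rfl fun r _ => Finset.sum_congr rfl fun s _ => ?_
  ring

structure SB (n : ℕ) (B : LinearMap.BilinForm ℂ (Fin (2 * n) → ℂ))
    (e f : Fin n → Fin (2 * n) → ℂ) : Prop where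
  ee : ∀ i j, B (e i) (e j) = 0
  ff : ∀ i j, B (f i) (f j) = 0
  ef : ∀ i j, B (e i) (f j) = if i = j then 1 else 0
  fe : ∀ i j, B (f i) (e j) = if i = j then -1 else 0

variable {n : ℕ} {B : LinearMap.BilinForm ℂ (Fin (2 * n) → ℂ)} {e f : Fin n → Fin (2 * n) → ℂ}

def cA (B : LinearMap.BilinForm ℂ (Fin (2 * n) → ℂ)) (f : Fin n → Fin (2 * n) → ℂ)
    (m : Fin (2 * n) × Fin n → ℂ) : Matrix (Fin n) (Fin n) ℂ :=
  Matrix.of fun i k => B (col m k) (f i)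

def cC (B : LinearMap.BilinForm ℂ (Fin (2 * n) → ℂ)) (e : Fin n → Fin (2 * n) → ℂ)
    (m : Fin (2 * n) × Fin n → ℂ) : Matrix (Fin n) (Fin n) ℂ :=
  Matrix.of fun i k => B (e i) (col m k)

theorem col_pt (P Q : Matrix (Fin n) (Fin n) ℂ) (k : Fin n) :
    col (pt e f P Q) k = ∑ i, (P i k • e i + Q i k • f i) := by
  funext r
  simp [col, pt, mul_comm]

theorem cA_pt (h : SB n B e f) (P Q : Matrix (Fin n) (Fin n) ℂ) : cA B f (pt e f P Q) = P := by
  ext i k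
  simp [cA, col_pt, h.ef, h.ff]

theorem cC_pt (h : SB n B e f) (P Q : Matrix (Fin n) (Fin n) ℂ) : cC B e (pt e f P Q) = Q := by
  ext i k
  simp [cC, col_pt, h.ef, h.ee]

theorem span_SB (h : SB n B e f) (v : Fin (2 * n) → ℂ) :
    ∑ i, (B v (f i) • e i + B (e i) v • f i) = v := by
  let g : ((Fin n → ℂ) × (Fin n → ℂ)) →ₗ[ℂ] (Fin (2 * n) → ℂ) :=
    { toFun := fun p => ∑ i, (p.1 i • e i + p.2 i • f i)
      map_add' := fun p q => by
        simp only [Prod.fst_add, Prod.snd_add, Pi.add_apply, add_smul, ← Finset.sum_add_distrib]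
        exact Finset.sum_congr rfl fun i _ => by abel
      map_smul' := fun c p => by
        simp [Finset.smul_sum, smul_add, smul_smul] }
  have hl : ∀ p : (Fin n → ℂ) × (Fin n → ℂ),
      ((fun i => B (g p) (f i), fun i => B (e i) (g p)) : (Fin n → ℂ) × (Fin n → ℂ)) = p := by
    intro p
    ext i <;> simp [g, h.ef, h.ee, h.ff]
  have hinj : Function.Injective g := by
    intro p q hpq
    rw [← hl p, ← hl q, hpq]
  have hsurj : Function.Surjective g :=
    (LinearMap.injective_iff_surjective_of_finrank_eq_finrank (by simp; ring)).1 hinj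
  obtain ⟨p, rfl⟩ := hsurj v
  conv_rhs => rw [← hl p]
  rfl

theorem pt_c (h : SB n B e f) (m : Fin (2 * n) × Fin n → ℂ) :
    pt e f (cA B f m) (cC B e m) = m := by
  funext ⟨r, k⟩
  have := congrFun (col_pt (e := e) (f := f) (cA B f m) (cC B e m) k) r
  have h2 := congrFun (span_SB h (col m k)) r
  exact this.trans h2

theorem bil_pt (h : SB n B e f) (P Q : Matrix (Fin n) (Fin n) ℂ) (k l : Fin n) :
    B (col (pt e f P Q) k) (col (pt e f P Q) l) = (Pᵀ * Q) k l - (Pᵀ * Q) l k := by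
  rw [col_pt, col_pt]
  simp [h.ef, h.ee, h.ff, h.fe, Matrix.mul_apply, Finset.sum_add_distrib]
  rw [sub_eq_add_neg]
  simp only [mul_comm (Q _ k)]

theorem lag_pt (h : SB n B e f) (P Q : Matrix (Fin n) (Fin n) ℂ) :
    (∀ k l, B (col (pt e f P Q) k) (col (pt e f P Q) l) = 0) ↔ (Pᵀ * Q)ᵀ = Pᵀ * Q := by
  simp only [bil_pt h, sub_eq_zero]
  constructor
  · intro h; ext i j; exact h j i
  · intro h k l; exact congrFun (congrFun h l) k

end Lag

namespace Lag
open Matrix Topology Filter MvPolynomial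
variable {n : ℕ} {B : LinearMap.BilinForm ℂ (Fin (2 * n) → ℂ)} {e f : Fin n → Fin (2 * n) → ℂ}

theorem vA_vC (x : EV n → ℂ) : (vA x)ᵀ * vC x = (vA x).det • vS x := by
  rw [vC, ← mul_assoc, ← transpose_mul, adjugate_mul, transpose_smul, transpose_one,
    Matrix.smul_mul, one_mul]

theorem vS_symm (x : EV n → ℂ) : (vS x)ᵀ = vS x := by
  ext i j
  simp [vS, Sym2.eq_swap]

theorem exists_param (P Q : Matrix (Fin n) (Fin n) ℂ) (h : (Pᵀ * Q)ᵀ = Pᵀ * Q) (hd : P.det ≠ 0) :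
    ∃ x : EV n → ℂ, vA x = P ∧ vC x = Q := by
  have hsym : ∀ i j, (Pᵀ * Q) i j = (Pᵀ * Q) j i := fun i j => congrFun (congrFun h j) i
  let x : EV n → ℂ := Sum.elim (fun p => P p.1 p.2)
    (Sym2.lift ⟨fun i j => P.det⁻¹ * (Pᵀ * Q) i j, fun i j => congrArg (P.det⁻¹ * ·) (hsym i j)⟩)
  have h1 : vA x = P := by ext i j; simp [vA, x]
  have h2 : vS x = P.det⁻¹ • (Pᵀ * Q) := by
    ext i j
    simp only [vS, x, Matrix.of_apply, Sum.elim_inr, Sym2.lift_mk, Matrix.smul_apply, smul_eq_mul]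
  refine ⟨x, h1, ?_⟩
  rw [vC, h1, h2, Matrix.mul_smul, ← mul_assoc, ← transpose_mul, mul_adjugate, transpose_smul,
    transpose_one, Matrix.smul_mul, one_mul, smul_smul, inv_mul_cancel₀ hd, one_smul]

def ML (B : LinearMap.BilinForm ℂ (Fin (2 * n) → ℂ)) : Set (Fin (2 * n) × Fin n → ℂ) :=
  {m | ∀ k l, B (col m k) (col m l) = 0}

theorem eval_aeval_FF (x : EV n → ℂ) (p : MvPolynomial (Fin (2 * n) × Fin n) ℂ) :
    eval x (aeval (FF e f) p) = eval (pt e f (vA x) (vC x)) p := by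
  rw [← eval_FF]
  rw [aeval_def, ← coe_eval₂Hom, ← RingHom.comp_apply]
  congr 1
  ext <;> simp

theorem vanishing_eq (h : SB n B e f) :
    (vanishingIdeal ℂ (ML B) : Ideal (MvPolynomial (Fin (2 * n) × Fin n) ℂ)) =
      RingHom.ker (aeval (R := ℂ) (FF e f)) := by
  ext p
  rw [RingHom.mem_ker]
  constructor
  · intro hp
    apply MvPolynomial.funext
    intro x
    rw [eval_aeval_FF, map_zero, ← aeval_eq_eval]
    apply hp
    change ∀ k l, _
    rw [lag_pt h, vA_vC, transpose_smul, vS_symm]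
  · intro hp m hm
    rw [aeval_eq_eval]
    have hm' : ∀ k l, B (col m k) (col m l) = 0 := hm
    rw [← pt_c h m, lag_pt h] at hm'
    obtain ⟨A', C', hA', hC', hA0, hC0, hs, hd⟩ := density _ _ hm'
    have hcont : Continuous fun s => eval (pt e f (A' s) (C' s)) p := by
      have h1 : Continuous fun s => pt e f (A' s) (C' s) := by
        unfold pt
        fun_prop
      exact (MvPolynomial.continuous_eval p).comp h1
    have hev : ∀ᶠ s in 𝓝[≠] (0 : ℂ), eval (pt e f (A' s) (C' s)) p = 0 := by
      filter_upwards [hd] with s hds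
      obtain ⟨x, hx1, hx2⟩ := exists_param _ _ (hs s) hds
      rw [← hx1, ← hx2, ← eval_aeval_FF, hp, map_zero]
    have ht : Tendsto (fun s => eval (pt e f (A' s) (C' s)) p) (𝓝[≠] (0 : ℂ))
        (𝓝 (eval (pt e f (A' 0) (C' 0)) p)) :=
      (hcont.tendsto 0).mono_left nhdsWithin_le_nhds
    have ht2 : Tendsto (fun s => eval (pt e f (A' s) (C' s)) p) (𝓝[≠] (0 : ℂ)) (𝓝 0) :=
      (tendsto_congr' hev).2 tendsto_const_nhds
    have := tendsto_nhds_unique ht ht2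
    rwa [hA0, hC0, pt_c h] at this

noncomputable def PA (B : LinearMap.BilinForm ℂ (Fin (2 * n) → ℂ)) (f : Fin n → Fin (2 * n) → ℂ)
    (i k : Fin n) : MvPolynomial (Fin (2 * n) × Fin n) ℂ :=
  ∑ r, C (B (Pi.single r 1) (f i)) * X (r, k)

noncomputable def PC (B : LinearMap.BilinForm ℂ (Fin (2 * n) → ℂ)) (e : Fin n → Fin (2 * n) → ℂ)
    (i k : Fin n) : MvPolynomial (Fin (2 * n) × Fin n) ℂ :=
  ∑ r, C (B (e i) (Pi.single r 1)) * X (r, k)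

theorem eval_PA (m : Fin (2 * n) × Fin n → ℂ) (i k : Fin n) :
    eval m (PA B f i k) = cA B f m i k := by
  simp only [PA, cA, map_sum, map_mul, eval_C, eval_X, Matrix.of_apply]
  conv_rhs => rw [pi_eq_sum_univ' (col m k)]
  simp [col, mul_comm]

theorem eval_PC (m : Fin (2 * n) × Fin n → ℂ) (i k : Fin n) :
    eval m (PC B e i k) = cC B e m i k := by
  simp only [PC, cC, map_sum, map_mul, eval_C, eval_X, Matrix.of_apply]
  conv_rhs => rw [pi_eq_sum_univ' (col m k)]
  simp [col, mul_comm]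

noncomputable def QQ (B : LinearMap.BilinForm ℂ (Fin (2 * n) → ℂ)) (e f : Fin n → Fin (2 * n) → ℂ) :
    EV n → MvPolynomial (Fin (2 * n) × Fin n) ℂ :=
  Sum.elim (fun p => PA B f p.1 p.2)
    fun z => ∑ i, PA B f i (Quot.out z).1 * PC B e i (Quot.out z).2

theorem eval_QQ (h : SB n B e f) (x : EV n → ℂ) :
    (fun z => eval (pt e f (vA x) (vC x)) (QQ B e f z)) =
      Sum.elim (fun p => x (Sum.inl p)) fun z => (vA x).det * x (Sum.inr z) := by
  funext z
  rcases z with ⟨i, k⟩ | z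
  · simp [QQ, eval_PA, cA_pt h, vA]
  · have h1 := congrFun (congrFun (vA_vC x) (Quot.out z).1) (Quot.out z).2
    have h2 : s((Quot.out z).1, (Quot.out z).2) = z := Quot.out_eq z
    simp only [QQ, Sum.elim_inr, map_sum, map_mul, eval_PA, eval_PC, cA_pt h, cC_pt h]
    simp only [vS, Matrix.smul_apply, Matrix.of_apply, h2, smul_eq_mul] at h1
    rw [← h1, Matrix.mul_apply]
    rfl

theorem QQ_inj (h : SB n B e f) (p : MvPolynomial (EV n) ℂ)
    (hp : aeval (FF e f) (aeval (QQ B e f) p) = 0) : p = 0 := by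
  have key : p * (XA n).det = 0 := by
    apply MvPolynomial.funext
    intro x
    have hdet : eval x (XA n).det = (vA x).det := by
      rw [RingHom.map_det, RingHom.mapMatrix_apply, map_XA]
    rw [map_mul, map_zero, hdet]
    by_cases hd : (vA x).det = 0
    · rw [hd, mul_zero]
    apply mul_eq_zero_of_left
    let y : EV n → ℂ := Sum.elim (fun p => x (Sum.inl p)) fun z => (vA x).det⁻¹ * x (Sum.inr z)
    have hy : vA y = vA x := by ext i j; simp [vA, y]
    have h1 : eval y (aeval (FF e f) (aeval (QQ B e f) p)) = 0 := by rw [hp, map_zero]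
    rw [eval_aeval_FF, aeval_def, ← coe_eval₂Hom, ← RingHom.comp_apply] at h1
    have h2 : ((eval (pt e f (vA y) (vC y))).comp
        (eval₂Hom (algebraMap ℂ (MvPolynomial (Fin (2 * n) × Fin n) ℂ)) (QQ B e f))) =
        eval fun z => eval (pt e f (vA y) (vC y)) (QQ B e f z) := by
      ext <;> simp
    rw [h2, eval_QQ h] at h1
    have h3 : (Sum.elim (fun p => y (Sum.inl p)) fun z => (vA y).det * y (Sum.inr z)) = x := by
      funext z
      rcases z with z | z
      · simp [y]
      · simp [hy, y, hd]
    rwa [h3] at h1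
  rcases mul_eq_zero.1 key with h0 | h0
  · exact h0
  · exfalso
    have := congrArg (eval (Sum.elim (fun p : Fin n × Fin n => if p.1 = p.2 then 1 else 0)
      fun _ => 0 : EV n → ℂ)) h0
    rw [RingHom.map_det, RingHom.mapMatrix_apply, map_XA, map_zero] at this
    have h1 : vA (Sum.elim (fun p : Fin n × Fin n => if p.1 = p.2 then 1 else 0)
      fun _ => 0 : EV n → ℂ) = 1 := by
      ext i j; simp [vA, Matrix.one_apply]
    rw [h1, det_one] at this
    exact one_ne_zero this

theorem card_EV (n : ℕ) : Fintype.card (EV n) = 2 * n ^ 2 - n * (n - 1) / 2 := by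
  rw [Fintype.card_sum, Fintype.card_prod, Sym2.card, Fintype.card_fin, Nat.choose_two_right]
  have h1 := Nat.div_mul_cancel (Nat.even_mul_pred_self n).two_dvd
  have h2 := Nat.div_mul_cancel (Nat.even_mul_pred_self (n + 1)).two_dvd
  have h3 : (n + 1) * (n + 1 - 1) + n * (n - 1) = 2 * n ^ 2 := by
    cases n
    · rfl
    · simp; ring
  have h4 : n ^ 2 = n * n := sq n
  omega

theorem dim_ML (h : SB n B e f) (halg : IsAlgSet (ML B)) :
    algDim (ML B) = ((2 * n ^ 2 - n * (n - 1) / 2 : ℕ) : WithBot ℕ∞) := by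
  rw [algDim_eq halg, vanishing_eq h]
  have : (RingHom.ker (aeval (R := ℂ) (FF e f))).IsPrime := RingHom.ker_isPrime _
  have htr : Algebra.trdeg ℂ (MvPolynomial (EV n) ℂ) = ((2 * n ^ 2 - n * (n - 1) / 2 : ℕ)) := by
    rw [MvPolynomial.trdeg_of_isDomain, ← card_EV]; simp
  apply dim_of_trdeg
  apply le_antisymm
  · rw [← htr]
    exact trdeg_le_of_injective (Ideal.kerLiftAlg (aeval (R := ℂ) (FF e f)))
      (Ideal.kerLiftAlg_injective _)
  · rw [← htr]
    apply trdeg_le_of_injective ((Ideal.Quotient.mkₐ ℂ _).comp (aeval (R := ℂ) (QQ B e f)))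
    rw [injective_iff_map_eq_zero]
    intro p hp
    apply QQ_inj h
    rw [AlgHom.comp_apply, Ideal.Quotient.mkₐ_eq_mk, Ideal.Quotient.eq_zero_iff_mem] at hp
    exact hp

noncomputable def EQ (B : LinearMap.BilinForm ℂ (Fin (2 * n) → ℂ)) (kl : Fin n × Fin n) :
    MvPolynomial (Fin (2 * n) × Fin n) ℂ :=
  ∑ r, ∑ s, C (B (Pi.single r 1) (Pi.single s 1)) * X (r, kl.1) * X (s, kl.2)

theorem eval_EQ (m : Fin (2 * n) × Fin n → ℂ) (kl : Fin n × Fin n) :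
    eval m (EQ B kl) = B (col m kl.1) (col m kl.2) := by
  rw [bilin_expand B]
  simp [EQ, col]

theorem card_pairs (n : ℕ) :
    (Finset.univ.filter fun kl : Fin n × Fin n => kl.1 < kl.2).card = n * (n - 1) / 2 := by
  rw [Finset.card_filter, Fintype.sum_prod_type_right]
  have : ∀ l : Fin n, (∑ k : Fin n, if k < l then 1 else 0) = (l : ℕ) := by
    intro l
    rw [← Finset.card_filter]
    have h : (Finset.univ.filter fun k : Fin n => k < l) = Finset.Iio l := by
      ext k
      rw [Finset.mem_filter, Finset.mem_Iio]
      exact ⟨fun h => h.2, fun h => ⟨Finset.mem_univ _, h⟩⟩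
    rw [h, Fin.card_Iio]
  refine (Finset.sum_congr rfl fun l _ => this l).trans ?_
  rw [Fin.sum_univ_eq_sum_range (fun i => i), Finset.sum_range_id]

end Lag

theorem stmt_2 (n : ℕ) (hn : 0 < n)
    (B : LinearMap.BilinForm ℂ (Fin (2 * n) → ℂ))
    (halt : ∀ v, B v v = 0)
    (hnondeg : ∀ v, (∀ w, B v w = 0) → v = 0)
    (Mlag : Set (Fin (2 * n) × Fin n → ℂ))
    (hMlag : Mlag = {m | ∀ x y : Fin n → ℂ,
      B (matToLin n m x) (matToLin n m y) = 0}) :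
    (∃ P : Finset (MvPolynomial (Fin (2 * n) × Fin n) ℂ),
        P.card = n * (n - 1) / 2 ∧
        Mlag = {x | ∀ p ∈ P, MvPolynomial.eval x p = 0}) ∧
    IsIrrAlg Mlag ∧
    algDim Mlag = ((2 * n ^ 2 - n * (n - 1) / 2 : ℕ) : WithBot ℕ∞) := by
  classical
  have hneg : ∀ v w, B v w = - B w v := by
    intro v w
    have := halt (v + w)
    simp only [map_add, LinearMap.add_apply, halt] at this
    linear_combination this
  obtain ⟨e, f, hee, hff, hef⟩ := Lag.symp_step B halt hnondeg n (by simp) n le_rfl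
  have hSB : Lag.SB n B e f := ⟨hee, hff, hef, fun i j => by
    rw [hneg, hef]
    by_cases h : i = j
    · simp [h]
    · simp [h, Ne.symm h]⟩
  have hML : Mlag = Lag.ML B := by
    rw [hMlag]
    ext m
    exact Lag.lag_iff B m
  have h1 : ∃ P : Finset (MvPolynomial (Fin (2 * n) × Fin n) ℂ),
        P.card = n * (n - 1) / 2 ∧
        Mlag = {x | ∀ p ∈ P, MvPolynomial.eval x p = 0} := by
    refine ⟨(Finset.univ.filter fun kl : Fin n × Fin n => kl.1 < kl.2).image (Lag.EQ B), ?_, ?_⟩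
    · rw [Finset.card_image_of_injOn, Lag.card_pairs]
      rintro ⟨k, l⟩ hkl ⟨k', l'⟩ hkl' heq
      replace hkl : k < l := by simpa using hkl
      replace hkl' : k' < l' := by simpa using hkl'
      let i₀ : Fin n := ⟨0, hn⟩
      let m : Fin (2 * n) × Fin n → ℂ := fun rk =>
        if rk.2 = k then e i₀ rk.1 else if rk.2 = l then f i₀ rk.1 else 0
      have hk : Lag.col m k = e i₀ := by funext r; simp [Lag.col, m]
      have hl : Lag.col m l = f i₀ := by funext r; simp [Lag.col, m, hkl.ne']
      have h0 : ∀ j, j ≠ k → j ≠ l → Lag.col m j = 0 := by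
        intro j h1 h2; funext r; simp [Lag.col, m, h1, h2]
      have := congrArg (MvPolynomial.eval m) heq
      rw [Lag.eval_EQ, Lag.eval_EQ] at this
      simp only [hk, hl, hef, if_true] at this
      have a1 : k' = k ∨ k' = l := by
        by_contra! hc
        rw [h0 k' hc.1 hc.2] at this
        simp at this
      have a2 : l' = k ∨ l' = l := by
        by_contra! hc
        rw [h0 l' hc.1 hc.2] at this
        simp at this
      rw [Prod.mk.injEq]
      omega
    · rw [hML]
      ext m
      constructor
      · intro h p hp
        obtain ⟨⟨k, l⟩, _, rfl⟩ := Finset.mem_image.1 hp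
        rw [Lag.eval_EQ]
        exact h k l
      · intro h0
        have h : ∀ k l, k < l → B (Lag.col m k) (Lag.col m l) = 0 := by
          intro k l hkl
          have h2 := h0 _ (Finset.mem_image.2 ⟨(k, l), by simpa using hkl, rfl⟩)
          rw [Lag.eval_EQ] at h2
          exact h2
        intro k l
        rcases lt_trichotomy k l with hlt | rfl | hlt
        · exact h k l hlt
        · exact halt _
        · rw [hneg, h l k hlt, neg_zero]
  have halg : IsAlgSet (Lag.ML B) := by
    obtain ⟨P, _, hP⟩ := h1
    exact ⟨(P : Set _), hML ▸ hP⟩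
  refine ⟨h1, ?_, ?_⟩
  · rw [hML, Lag.isIrr_iff halg, Lag.vanishing_eq hSB]
    exact RingHom.ker_isPrime _
  · rw [hML]
    exact Lag.dim_ML hSB halg
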